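/- There exist constants c and C such that for every natural number n and all natural numbers α0, β0 with α0 + β0 < n − c·log n − C, there is a binary string x of length n that is not (α0,β0)-stochastic, i.e., β_x(α0) > β0. -/

import Mathlib

open scoped Classical

/-- Binary strings. -/
abbrev BStr : Type := List Bool

/-- A prefix (Turing) machine: a partial computable map taking a program and an
auxiliary input to an output, such that for each auxiliary input the set of
halting programs is prefix-free. -/
structure PrefixMachine where
  eval : BStr → BStr → Part BStr
  partrec' : Partrec fun p : BStr × BStr => eval p.1 p.2
  prefixFree : ∀ y p q, (eval p y).Dom → (eval q y).Dom → p <+: q → p = q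

/-- A universal prefix machine: it simulates every prefix machine via a fixed
self-delimiting prefix. -/
structure UniversalPrefixMachine extends PrefixMachine where
  universal : ∀ M : PrefixMachine, ∃ s : BStr, ∀ p y,
    toPrefixMachine.eval (s ++ p) y = M.eval p y

/-- Canonical binary-string encoding of an encodable object (e.g. a natural
number, a pair, or a finite set of strings, the latter representing a literal
listing of the set). -/
def code {α : Type} [Encodable α] (a : α) : BStr := Nat.bits (Encodable.encode a)

namespace UniversalPrefixMachine

variable (U : UniversalPrefixMachine)

/-- Conditional prefix Kolmogorov complexity `K(x|y)` of a string given a string. -/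
noncomputable def Kc (x y : BStr) : ℕ :=
  sInf {n | ∃ p : BStr, p.length = n ∧ x ∈ U.eval p y}

/-- Prefix Kolmogorov complexity `K(x)`. -/
noncomputable def K (x : BStr) : ℕ := U.Kc x []

/-- `K(x|S)`: conditional complexity of `x` given a literal listing of the finite set `S`. -/
noncomputable def KcS (x : BStr) (S : Finset BStr) : ℕ := U.Kc x (code S)

/-- `K(S)`: complexity of a listing of the finite set `S`. -/
noncomputable def Kset (S : Finset BStr) : ℕ := U.K (code S)

/-- `K(P|S)`: conditional complexity of a listing of `P` given a listing of `S`. -/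
noncomputable def KsetCond (P S : Finset BStr) : ℕ := U.Kc (code P) (code S)

/-- `K(S|x)`: conditional complexity of a listing of `S` given the string `x`. -/
noncomputable def KsetGivenStr (S : Finset BStr) (x : BStr) : ℕ := U.Kc (code S) x

/-- `K(n)` for a natural number `n`. -/
noncomputable def Knat (n : ℕ) : ℕ := U.K (code n)

/-- `K(a|b)` for natural numbers `a`, `b`. -/
noncomputable def KnatCond (a b : ℕ) : ℕ := U.Kc (code a) (code b)

/-- Randomness deficiency `δ(x|S) = log|S| - K(x|S)` (logarithm base 2). -/
noncomputable def deficiency (x : BStr) (S : Finset BStr) : ℝ :=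
  Real.logb 2 (S.card : ℝ) - (U.KcS x S : ℝ)

/-- `Λ(S) = K(S) + log|S|`. -/
noncomputable def Lam (S : Finset BStr) : ℝ :=
  (U.Kset S : ℝ) + Real.logb 2 (S.card : ℝ)

/-- Kolmogorov structure function `h_x(α) = min{log|S| : x ∈ S, K(S) ≤ α}`
(the minimum of the empty set being `⊤`). -/
noncomputable def h (x : BStr) (α : ℕ) : EReal :=
  sInf {r : EReal | ∃ S : Finset BStr,
    x ∈ S ∧ U.Kset S ≤ α ∧ r = ((Real.logb 2 (S.card : ℝ)) : EReal)}

/-- MDL structure function `λ_x(α) = min{Λ(S) : x ∈ S, K(S) ≤ α}`. -/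
noncomputable def lambdaF (x : BStr) (α : ℕ) : EReal :=
  sInf {r : EReal | ∃ S : Finset BStr,
    x ∈ S ∧ U.Kset S ≤ α ∧ r = ((U.Lam S) : EReal)}

/-- Best-fit structure function `β_x(α) = min{δ(x|S) : x ∈ S, K(S) ≤ α}`. -/
noncomputable def betaF (x : BStr) (α : ℕ) : EReal :=
  sInf {r : EReal | ∃ S : Finset BStr,
    x ∈ S ∧ U.Kset S ≤ α ∧ r = ((U.deficiency x S) : EReal)}

end UniversalPrefixMachine

/-- `f` is `(ε,δ)`-close to `g` on `{0,…,k}`. -/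
def IsClose (k : ℕ) (ε δ : ℕ → ℕ) (f g : ℕ → EReal) : Prop :=
  ∀ i, ε 0 ≤ i → i ≤ k →
    sInf {r : EReal | ∃ j, ε 0 ≤ j ∧ j ≤ k ∧ Nat.dist j i ≤ ε i ∧ r = g j}
        - (((δ i : ℕ) : ℝ) : EReal) ≤ f i ∧
    f i ≤ sSup {r : EReal | ∃ j, ε 0 ≤ j ∧ j ≤ k ∧ Nat.dist j i ≤ ε i ∧ r = g j}
        + (((δ i : ℕ) : ℝ) : EReal)


namespace NS
open Encodable

/-- Value of a little-endian bit string. -/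
def val (w : BStr) : ℕ := w.foldr (fun b n => Nat.bit b n) 0

theorem val_bits (n : ℕ) : val (Nat.bits n) = n := by
  induction n using Nat.binaryRec' with
  | zero => simp [val]
  | bit b n h ih =>
    rw [Nat.bits_append_bit n b h]
    simp only [val, List.foldr_cons] at ih ⊢
    rw [ih]

theorem val_append_false (w : BStr) (k : ℕ) : val (w ++ List.replicate k false) = val w := by
  induction w with
  | nil =>
    induction k with
    | zero => rfl
    | succ k ih =>
      simp only [val, List.nil_append, List.replicate_succ, List.foldr_cons] at ih ⊢
      rw [ih]; rfl
  | cons b w ih =>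
    simp only [val, List.cons_append, List.foldr_cons] at ih ⊢
    rw [ih]

theorem exists_val {i l : ℕ} (h : i < 2 ^ l) : ∃ w : BStr, w.length = l ∧ val w = i := by
  refine ⟨Nat.bits i ++ List.replicate (l - (Nat.bits i).length) false, ?_, ?_⟩
  · have : (Nat.bits i).length ≤ l := by
      rw [Nat.size_eq_bits_len]; exact Nat.size_le.2 h
    simp; omega
  · rw [val_append_false, val_bits]

theorem primrec_val : Primrec val := by
  have h : Primrec₂ (fun (_ : BStr) (q : Bool × ℕ) => Nat.bit q.1 q.2) := by
    have : Primrec₂ (fun (_ : BStr) (q : Bool × ℕ) => bif q.1 then 2 * q.2 + 1 else 2 * q.2) := by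
      have h1 : Primrec (fun a : BStr × (Bool × ℕ) => a.2.1) := Primrec.fst.comp Primrec.snd
      have h2 : Primrec (fun a : BStr × (Bool × ℕ) => a.2.2) := Primrec.snd.comp Primrec.snd
      exact Primrec.cond h1 (Primrec.nat_double_succ.comp h2) (Primrec.nat_double.comp h2)
    refine this.of_eq ?_
    rintro _ ⟨b, n⟩
    cases b <;> rfl
  exact Primrec.list_foldr Primrec.id (Primrec.const 0) h

/-- One step of duplicate-free enumeration. -/
def stepL (l : List BStr) (o : Option BStr) : List BStr :=
  Option.casesOn o l (fun x => if x ∈ l then l else l ++ [x])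

/-- Duplicate-free list of elements enumerated by `F` before time `t`. -/
def enumL (F : ℕ → Option BStr) (t : ℕ) : List BStr :=
  Nat.rec [] (fun t l => stepL l (F t)) t

theorem enumL_succ (F : ℕ → Option BStr) (t : ℕ) : enumL F (t + 1) = stepL (enumL F t) (F t) := rfl

theorem mem_stepL (l : List BStr) (o : Option BStr) (x : BStr) :
    x ∈ stepL l o ↔ x ∈ l ∨ o = some x := by
  cases o with
  | none => simp [stepL]
  | some z =>
    simp only [stepL]
    split_ifs with h
    · constructor
      · exact Or.inl
      · rintro (h' | h')
        · exact h'
        · cases h'; exact h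
    · simp [eq_comm]

theorem prefix_stepL (l : List BStr) (o : Option BStr) : l <+: stepL l o := by
  cases o with
  | none => exact List.prefix_rfl
  | some z =>
    simp only [stepL]
    split_ifs with h
    · exact List.prefix_rfl
    · exact List.prefix_append _ _

theorem nodup_stepL (l : List BStr) (o : Option BStr) (hl : l.Nodup) : (stepL l o).Nodup := by
  cases o with
  | none => exact hl
  | some z =>
    simp only [stepL]
    split_ifs with h
    · exact hl
    · rw [List.nodup_append]
      refine ⟨hl, by simp, ?_⟩
      intro a ha b hb
      simp at hb
      rintro rfl
      exact h (hb ▸ ha)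

theorem mem_enumL (F : ℕ → Option BStr) (t : ℕ) (x : BStr) :
    x ∈ enumL F t ↔ ∃ u < t, F u = some x := by
  induction t with
  | zero => simp [enumL]
  | succ t ih =>
    rw [enumL_succ, mem_stepL, ih]
    constructor
    · rintro (⟨u, hu, h⟩ | h)
      · exact ⟨u, by omega, h⟩
      · exact ⟨t, by omega, h⟩
    · rintro ⟨u, hu, h⟩
      rcases Nat.lt_succ_iff_lt_or_eq.1 hu with h' | rfl
      · exact Or.inl ⟨u, h', h⟩
      · exact Or.inr h

theorem nodup_enumL (F : ℕ → Option BStr) (t : ℕ) : (enumL F t).Nodup := by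
  induction t with
  | zero => simp [enumL]
  | succ t ih => exact nodup_stepL _ _ ih

theorem prefix_enumL (F : ℕ → Option BStr) {t t' : ℕ} (h : t ≤ t') : enumL F t <+: enumL F t' := by
  induction h with
  | refl => exact List.prefix_rfl
  | step _ ih => exact ih.trans (prefix_stepL _ _)

theorem primrec_mem {α β : Type} [Primcodable α] [Primcodable β] {f : α → β} {g : α → List β}
    (hf : Primrec f) (hg : Primrec g) : PrimrecPred fun a => f a ∈ g a := by
  have h := (PrimrecRel.exists_mem_list (Primrec.eq (α := β))).comp hg hf
  exact h.of_eq (fun a => by simp)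

theorem primrec_enumL {α : Type} [Primcodable α] {E : α → ℕ → Option BStr} (hE : Primrec₂ E) :
    Primrec₂ fun a t => enumL (E a) t := by
  have h : Primrec₂ (fun (a : α) (q : ℕ × List BStr) => stepL q.2 (E a q.1)) := by
    have h1 : Primrec (fun r : α × (ℕ × List BStr) => r.2.2) := Primrec.snd.comp Primrec.snd
    have h2 : Primrec (fun r : α × (ℕ × List BStr) => E r.1 r.2.1) :=
      hE.comp Primrec.fst (Primrec.fst.comp Primrec.snd)
    refine Primrec.option_casesOn h2 h1 ?_
    have h3 : Primrec (fun r : (α × (ℕ × List BStr)) × BStr => r.1.2.2) := h1.comp Primrec.fst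
    exact Primrec.ite (primrec_mem Primrec.snd h3) h3
      (Primrec.list_concat.comp h3 Primrec.snd)
  exact Primrec.nat_rec (Primrec.const []) h

/-- Length of the unary header. -/
def hdr (p : BStr) : ℕ := (p.takeWhile id).length

/-- The number stored in the header. -/
def hnum (p : BStr) : ℕ := val ((p.drop (hdr p + 1)).take (hdr p))

theorem hdr_append {p r : BStr} (h : hdr p < p.length) : hdr (p ++ r) = hdr p := by
  induction p with
  | nil => simp at h
  | cons b p ih =>
    cases b with
    | false => simp [hdr]
    | true =>
      simp [hdr] at h ih ⊢
      exact ih h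

theorem primrec_hdr : Primrec hdr :=
  Primrec.list_length.comp (Primrec.list_takeWhile Primrec.id)

theorem primrec_hnum : Primrec hnum :=
  primrec_val.comp (Primrec.list_take.comp primrec_hdr
    (Primrec.list_drop.comp (Primrec.succ.comp primrec_hdr) Primrec.id))

/-- Parse a self-delimiting program: parameters and an index. -/
def parse (μ : Type) [Primcodable μ] (p : BStr) : Option (μ × ℕ) :=
  if p.length = 2 * hdr p + 1 + (hnum p).unpair.1 then
    (decode (hnum p).unpair.2 : Option μ).map (fun m => (m, val (p.drop (2 * hdr p + 1))))
  else none

theorem primrec_parse (μ : Type) [Primcodable μ] : Primrec (parse μ) := by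
  have h2 : Primrec (fun p : BStr => 2 * hdr p + 1) := Primrec.nat_double_succ.comp primrec_hdr
  have hu := Primrec.unpair.comp primrec_hnum
  refine Primrec.ite ?_ ?_ (Primrec.const none)
  · exact Primrec.eq.comp Primrec.list_length (Primrec.nat_add.comp h2 (Primrec.fst.comp hu))
  · refine Primrec.option_map (Primrec.decode.comp (Primrec.snd.comp hu)) ?_
    exact Primrec.pair Primrec.snd
      (primrec_val.comp (Primrec.list_drop.comp (h2.comp Primrec.fst) Primrec.fst))

theorem parse_pfree (μ : Type) [Primcodable μ] {p q : BStr} (hp : (parse μ p).isSome)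
    (hq : (parse μ q).isSome) (h : p <+: q) : p = q := by
  have key : ∀ p : BStr, (parse μ p).isSome → p.length = 2 * hdr p + 1 + (hnum p).unpair.1 := by
    intro p hp
    unfold parse at hp
    split_ifs at hp with h'
    · exact h'
    · simp at hp
  have hp' := key p hp
  have hq' := key q hq
  obtain ⟨r, rfl⟩ := h
  have e1 : hdr (p ++ r) = hdr p := hdr_append (by omega)
  have e2 : hnum (p ++ r) = hnum p := by
    unfold hnum
    rw [e1, List.drop_append_of_le_length (by omega),
      List.take_append_of_le_length (by rw [List.length_drop]; omega)]
  rw [e1, e2] at hq'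
  rw [← hp', List.length_append] at hq'
  have : r = [] := List.length_eq_zero_iff.1 (by omega)
  simp [this]

/-- Stage `t` of the machine attached to an enumeration. -/
def stageM {μ : Type} [Primcodable μ] (E : μ × BStr → ℕ → Option BStr)
    (a : BStr × BStr) (t : ℕ) : Option BStr :=
  (parse μ a.1).bind (fun q => (enumL (E (q.1, a.2)) t)[q.2]?)

theorem primrec_stageM {μ : Type} [Primcodable μ] (E : μ × BStr → ℕ → Option BStr)
    (hE : Primrec₂ E) : Primrec₂ (stageM E) := by
  have h0 : Primrec (fun r : (BStr × BStr) × ℕ => parse μ r.1.1) :=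
    (primrec_parse μ).comp (Primrec.fst.comp Primrec.fst)
  have a1 : Primrec (fun r : ((BStr × BStr) × ℕ) × (μ × ℕ) => (r.2.1, r.1.1.2)) :=
    Primrec.pair (Primrec.fst.comp Primrec.snd)
      (Primrec.snd.comp (Primrec.fst.comp Primrec.fst))
  have a2 : Primrec (fun r : ((BStr × BStr) × ℕ) × (μ × ℕ) => r.1.2) :=
    Primrec.snd.comp Primrec.fst
  have a3 : Primrec (fun r : ((BStr × BStr) × ℕ) × (μ × ℕ) => r.2.2) :=
    Primrec.snd.comp Primrec.snd
  have a4 : Primrec (fun r : ((BStr × BStr) × ℕ) × (μ × ℕ) =>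
      enumL (E (r.2.1, r.1.1.2)) r.1.2) := (primrec_enumL hE).comp a1 a2
  have h1 : Primrec₂ (fun (r : (BStr × BStr) × ℕ) (q : μ × ℕ) =>
      (enumL (E (q.1, r.1.2)) r.2)[q.2]?) := Primrec.list_getElem?.comp a4 a3
  exact Primrec.option_bind h0 h1

/-- The prefix machine attached to an enumeration. -/
def enumMachine {μ : Type} [Primcodable μ] (E : μ × BStr → ℕ → Option BStr)
    (hE : Primrec₂ E) : PrefixMachine where
  eval p y := Nat.rfindOpt (stageM E (p, y))
  partrec' := Partrec.rfindOpt (primrec_stageM E hE).to_comp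
  prefixFree := by
    intro y p q hp hq h
    have key : ∀ p : BStr, (Nat.rfindOpt (stageM E (p, y))).Dom → (parse μ p).isSome := by
      intro p hp
      obtain ⟨n, a, h⟩ := Nat.rfindOpt_dom.1 hp
      unfold stageM at h
      cases hh : parse μ p with
      | none => rw [hh] at h; simp at h
      | some _ => rfl
    exact parse_pfree μ (key p hp) (key q hq) h

theorem enum_bound (U : UniversalPrefixMachine) {μ : Type} [Primcodable μ]
    (E : μ × BStr → ℕ → Option BStr) (hE : Primrec₂ E) :
    ∃ c : ℕ, ∀ (m : μ) (y : BStr) (l : ℕ) (x : BStr), (∃ t, E (m, y) t = some x) →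
      (∀ T, (enumL (E (m, y)) T).length ≤ 2 ^ l) →
      ∃ p : BStr, p.length ≤ l + 2 * Nat.size (Nat.pair l (encode m)) + c ∧ x ∈ U.eval p y := by
  obtain ⟨s, hs⟩ := U.universal (enumMachine E hE)
  refine ⟨s.length + 1, ?_⟩
  rintro m y l x ⟨t, ht⟩ hl
  have hx : x ∈ enumL (E (m, y)) (t + 1) := (mem_enumL _ _ _).2 ⟨t, by omega, ht⟩
  obtain ⟨i, hi, hix⟩ := List.mem_iff_getElem.1 hx
  obtain ⟨w, hw, hwi⟩ := exists_val (lt_of_lt_of_le hi (hl _))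
  set q := Nat.pair l (encode m) with hq
  set p : BStr := List.replicate (Nat.size q) true ++ false :: (Nat.bits q ++ w) with hp
  have e1 : hdr p = Nat.size q := by
    rw [hp, hdr]
    generalize Nat.size q = k
    induction k with
    | zero => simp
    | succ k ih => simp [List.replicate_succ]
  have hb : (Nat.bits q).length = Nat.size q := Nat.size_eq_bits_len q
  have e2 : hnum p = q := by
    rw [hnum, e1, hp]
    rw [List.drop_append, List.drop_eq_nil_of_le (by simp)]
    simp [hb.symm, val_bits]
  have e3 : p.drop (2 * Nat.size q + 1) = w := by
    rw [hp, List.drop_append, List.drop_eq_nil_of_le (by simp; omega)]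
    have : 2 * Nat.size q + 1 - (List.replicate (Nat.size q) true).length
      = (Nat.bits q).length + 1 := by simp [hb]; omega
    rw [this]; simp
  have e4 : p.length = 2 * Nat.size q + 1 + l := by
    rw [hp]; simp [hb, hw]; omega
  have e5 : parse μ p = some (m, i) := by
    rw [parse, e1, e2, e3, e4, hq]
    simp [hwi]
  refine ⟨s ++ p, by rw [List.length_append]; omega, ?_⟩
  have : U.eval (s ++ p) y = _ := hs p y
  rw [this]
  change x ∈ Nat.rfindOpt (stageM E (p, y))
  have e6 : ∀ u, stageM E (p, y) u = (enumL (E (m, y)) u)[i]? := by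
    intro u
    simp [stageM, e5]
  rw [Nat.rfindOpt_mono]
  · refine ⟨t + 1, ?_⟩
    simp [e6, hi, hix]
  · intro a u v huv h
    simp only [e6, Option.mem_def] at h ⊢
    obtain ⟨r, hr⟩ := prefix_enumL (E (m, y)) huv
    rw [← hr, List.getElem?_append_left]
    · exact h
    · exact (List.getElem?_eq_some_iff.1 h).1

/-- All strings of length `n`. -/
def allStr (n : ℕ) : List BStr :=
  Nat.rec [[]] (fun _ l => l.map (List.cons true) ++ l.map (List.cons false)) n

theorem allStr_succ (n : ℕ) :
    allStr (n + 1) = (allStr n).map (List.cons true) ++ (allStr n).map (List.cons false) := rfl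

theorem mem_allStr (n : ℕ) (x : BStr) : x ∈ allStr n ↔ x.length = n := by
  induction n generalizing x with
  | zero => simp [allStr]
  | succ n ih =>
    rw [allStr_succ]
    cases x with
    | nil => simp
    | cons b x => cases b <;> simp [ih]

theorem length_allStr (n : ℕ) : (allStr n).length = 2 ^ n := by
  induction n with
  | zero => simp [allStr]
  | succ n ih => rw [allStr_succ]; simp [ih, pow_succ]; omega

theorem nodup_allStr (n : ℕ) : (allStr n).Nodup := by
  induction n with
  | zero => simp [allStr]
  | succ n ih =>
    rw [allStr_succ, List.nodup_append]
    refine ⟨ih.map (List.cons_injective), ih.map (List.cons_injective), ?_⟩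
    intro a ha b hb
    simp at ha hb
    obtain ⟨a, _, rfl⟩ := ha
    obtain ⟨b, _, rfl⟩ := hb
    simp

theorem primrec_allStr : Primrec allStr := by
  refine Primrec.nat_rec₁ (f := fun (_ : ℕ) (l : List BStr) =>
    l.map (List.cons true) ++ l.map (List.cons false)) [[]] ?_
  have h : ∀ b : Bool, Primrec (fun q : ℕ × List BStr => q.2.map (List.cons b)) := fun b =>
    Primrec.list_map Primrec.snd (Primrec.list_cons.comp (Primrec.const b) Primrec.snd)
  exact Primrec.list_append.comp (h true) (h false)

/-- All strings of length at most `n`. -/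
def leStr (n : ℕ) : List BStr := (List.range (n + 1)).flatMap allStr

theorem mem_leStr (n : ℕ) (x : BStr) : x ∈ leStr n ↔ x.length ≤ n := by
  simp [leStr, mem_allStr]

theorem nodup_leStr (n : ℕ) : (leStr n).Nodup := by
  rw [leStr, List.nodup_flatMap]
  refine ⟨fun k _ => nodup_allStr k, ?_⟩
  refine (List.nodup_range (n := n + 1)).imp ?_
  intro a b hab x hx hy
  rw [mem_allStr] at hx hy
  exact hab (hx.symm.trans hy)

theorem primrec_leStr : Primrec leStr :=
  Primrec.list_flatMap (Primrec.list_range.comp Primrec.succ) (primrec_allStr.comp Primrec.snd)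

theorem primrec_two_pow : Primrec (fun n : ℕ => 2 ^ n) := by
  have := Primrec.nat_rec₁ (f := fun (_ : ℕ) (k : ℕ) => 2 * k) 1
    (Primrec.nat_double.comp Primrec.snd)
  refine this.of_eq (fun n => ?_)
  induction n with
  | zero => rfl
  | succ n ih => simp only [pow_succ] at ih ⊢; rw [ih]; ring

/-- The list coded by a string. -/
def lst (y : BStr) : List BStr := (decode (val y) : Option (List BStr)).getD []

theorem primrec_lst : Primrec lst :=
  Primrec.option_getD.comp (Primrec.decode.comp primrec_val) (Primrec.const [])

theorem lst_code (S : Finset BStr) : ((lst (code S) : List BStr) : Multiset BStr) = S.val := by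
  have h : decode (encode S) = some S := encodek S
  have h2 : (decode (encode S.val) : Option (Multiset BStr)) = some S.val := encodek S.val
  have h3 : (decode (encode S.val) : Option (Multiset BStr)) =
    (decode (α := List BStr) (encode S.val)).map (fun l : List BStr => (l : Multiset BStr)) := rfl
  have h4 : encode S = encode S.val := rfl
  rw [lst, code, val_bits, h4]
  rw [h3] at h2
  obtain ⟨l, hl, hl'⟩ := Option.map_eq_some_iff.1 h2
  rw [hl]
  exact hl'

theorem mem_lst_code (S : Finset BStr) (x : BStr) : x ∈ lst (code S) ↔ x ∈ S := by
  rw [← Finset.mem_val, ← lst_code]; simp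

theorem length_lst_code (S : Finset BStr) : (lst (code S)).length = S.card := by
  rw [Finset.card_def, ← lst_code]; simp

/-- Truncated log-size. -/
def lev (n : ℕ) (y : BStr) : ℕ := Nat.findGreatest (fun k => 2 ^ k ≤ (lst y).length) n

theorem primrec_lev : Primrec₂ lev := by
  refine Primrec.nat_findGreatest (f := fun r : ℕ × BStr => r.1)
    (p := fun (r : ℕ × BStr) k => 2 ^ k ≤ (lst r.2).length) Primrec.fst ?_
  exact Primrec.nat_le.comp (primrec_two_pow.comp Primrec.snd)
    (Primrec.list_length.comp (primrec_lst.comp (Primrec.snd.comp Primrec.fst)))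

theorem lev_le (n : ℕ) (y : BStr) : lev n y ≤ n := Nat.findGreatest_le n

theorem two_pow_lev_le (n : ℕ) (y : BStr) (h : lst y ≠ []) : 2 ^ lev n y ≤ (lst y).length := by
  refine Nat.findGreatest_spec (P := fun k => 2 ^ k ≤ (lst y).length) (Nat.zero_le n) ?_
  have := List.length_pos_iff.2 h
  change 2 ^ 0 ≤ (lst y).length
  rw [pow_zero]
  exact this

theorem card_filter_lst (n : ℕ) (y : BStr) :
    ((allStr n).toFinset.filter (fun x => x ∈ lst y)).card ≤ 2 ^ (lev n y + 1) := by
  rcases (lev_le n y).lt_or_eq with h | h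
  · have h1 : ¬ 2 ^ (lev n y + 1) ≤ (lst y).length :=
      Nat.findGreatest_is_greatest (P := fun k => 2 ^ k ≤ (lst y).length) (Nat.lt_succ_self _) h
    calc _ ≤ (lst y).toFinset.card := Finset.card_le_card (by
            intro x hx; simp at hx ⊢; exact hx.2)
      _ ≤ (lst y).length := List.toFinset_card_le _
      _ ≤ _ := by omega
  · calc _ ≤ (allStr n).toFinset.card := Finset.card_filter_le _ _
      _ ≤ (allStr n).length := List.toFinset_card_le _
      _ = 2 ^ n := length_allStr n
      _ ≤ _ := by rw [h]; exact Nat.pow_le_pow_right (by norm_num) (by omega)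

section process
variable (out : ℕ → BStr → Option BStr)

/-- Weight contributed by program `p` to string `x`. -/
def pw (al n t : ℕ) (x p : BStr) : ℕ :=
  Option.casesOn (out t p) 0
    (fun y => if x ∈ lst y then 2 ^ (al - p.length) * 2 ^ (n - lev n y) else 0)

/-- Total weight. -/
def wt (al n t : ℕ) (x : BStr) : ℕ := (leStr al).foldr (fun p s => pw out al n t x p + s) 0

theorem wt_eq (al n t : ℕ) (x : BStr) :
    wt out al n t x = ∑ p ∈ (leStr al).toFinset, pw out al n t x p := by
  rw [List.sum_toFinset _ (nodup_leStr al), wt]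
  generalize leStr al = l
  induction l with
  | nil => rfl
  | cons a l ih => simp [ih]

/-- The current candidate. -/
def cand (al n t : ℕ) : BStr :=
  (allStr n).getD
    ((allStr n).findIdx (fun x => decide (wt out al n t x ≤ (al + 1) * 2 ^ (al + 2)))) []

/-- Enumeration of candidates in the set coded by `y`. -/
def E2 (q : (ℕ × ℕ × ℕ) × BStr) (t : ℕ) : Option BStr :=
  if cand out q.1.2.1 q.1.1 t ∈ lst q.2 ∧ ∃ p ∈ allStr q.1.2.2, out t p = some q.2 then
    some (cand out q.1.2.1 q.1.1 t) else none

/-- Enumeration of the bad sets. -/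
def E1 (q : ((ℕ × ℕ × ℕ) × (ℕ × ℕ)) × BStr) (t : ℕ) : Option BStr :=
  (decode t.unpair.2 : Option BStr).bind fun p => (out t.unpair.1 p).bind fun y =>
    if (p.length = q.1.1.2.2 ∧ lev q.1.1.1 y = q.1.2.1) ∧
      2 ^ (q.1.2.1 + q.1.1.2.1 + q.1.2.2) ≤
        (enumL (E2 out (q.1.1, y)) t.unpair.1).length * 2 ^ q.1.1.1 then
      some y else none

variable {out}

theorem primrec_pw (ho : Primrec₂ out) :
    Primrec (fun r : ((ℕ × ℕ × ℕ) × BStr) × BStr => pw out r.1.1.1 r.1.1.2.1 r.1.1.2.2 r.1.2 r.2) := by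
  have h0 : Primrec (fun r : ((ℕ × ℕ × ℕ) × BStr) × BStr => out r.1.1.2.2 r.2) :=
    ho.comp (Primrec.snd.comp (Primrec.snd.comp (Primrec.fst.comp Primrec.fst))) Primrec.snd
  have hal : Primrec (fun r : (((ℕ × ℕ × ℕ) × BStr) × BStr) × BStr => r.1.1.1.1) :=
    Primrec.fst.comp (Primrec.fst.comp (Primrec.fst.comp Primrec.fst))
  have hn : Primrec (fun r : (((ℕ × ℕ × ℕ) × BStr) × BStr) × BStr => r.1.1.1.2.1) :=
    Primrec.fst.comp (Primrec.snd.comp (Primrec.fst.comp (Primrec.fst.comp Primrec.fst)))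
  have hx : Primrec (fun r : (((ℕ × ℕ × ℕ) × BStr) × BStr) × BStr => r.1.1.2) :=
    Primrec.snd.comp (Primrec.fst.comp Primrec.fst)
  have hp : Primrec (fun r : (((ℕ × ℕ × ℕ) × BStr) × BStr) × BStr => r.1.2) :=
    Primrec.snd.comp Primrec.fst
  have hy : Primrec (fun r : (((ℕ × ℕ × ℕ) × BStr) × BStr) × BStr => r.2) := Primrec.snd
  have h1 : Primrec (fun r : (((ℕ × ℕ × ℕ) × BStr) × BStr) × BStr =>
      if r.1.1.2 ∈ lst r.2 then 2 ^ (r.1.1.1.1 - r.1.2.length) *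
        2 ^ (r.1.1.1.2.1 - lev r.1.1.1.2.1 r.2) else 0) := by
    refine Primrec.ite (primrec_mem hx (primrec_lst.comp hy)) ?_ (Primrec.const 0)
    exact Primrec.nat_mul.comp
      (primrec_two_pow.comp (Primrec.nat_sub.comp hal (Primrec.list_length.comp hp)))
      (primrec_two_pow.comp (Primrec.nat_sub.comp hn (primrec_lev.comp hn hy)))
  exact Primrec.option_casesOn h0 (Primrec.const 0) h1.to₂

theorem primrec_wt (ho : Primrec₂ out) :
    Primrec (fun r : (ℕ × ℕ × ℕ) × BStr => wt out r.1.1 r.1.2.1 r.1.2.2 r.2) := by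
  have h : Primrec (fun r : ((ℕ × ℕ × ℕ) × BStr) × (BStr × ℕ) =>
      pw out r.1.1.1 r.1.1.2.1 r.1.1.2.2 r.1.2 r.2.1 + r.2.2) := by
    have a : Primrec (fun r : ((ℕ × ℕ × ℕ) × BStr) × (BStr × ℕ) => (r.1, r.2.1)) :=
      Primrec.pair Primrec.fst (Primrec.fst.comp Primrec.snd)
    exact Primrec.nat_add.comp ((primrec_pw ho).comp a) (Primrec.snd.comp Primrec.snd)
  exact Primrec.list_foldr (primrec_leStr.comp (Primrec.fst.comp Primrec.fst))
    (Primrec.const 0) h.to₂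

theorem primrec_cand (ho : Primrec₂ out) :
    Primrec (fun r : ℕ × ℕ × ℕ => cand out r.1 r.2.1 r.2.2) := by
  have hl : Primrec (fun r : ℕ × ℕ × ℕ => allStr r.2.1) :=
    primrec_allStr.comp (Primrec.fst.comp Primrec.snd)
  have hal : Primrec (fun r : (ℕ × ℕ × ℕ) × BStr => r.1.1) := Primrec.fst.comp Primrec.fst
  have hd : Primrec (fun r : (ℕ × ℕ × ℕ) × BStr =>
      decide (wt out r.1.1 r.1.2.1 r.1.2.2 r.2 ≤ (r.1.1 + 1) * 2 ^ (r.1.1 + 2))) := by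
    refine PrimrecPred.decide ?_
    exact Primrec.nat_le.comp (primrec_wt ho)
      (Primrec.nat_mul.comp (Primrec.succ.comp hal)
        (primrec_two_pow.comp (Primrec.succ.comp (Primrec.succ.comp hal))))
  exact (Primrec.list_getD []).comp hl (Primrec.list_findIdx hl hd.to₂)

theorem primrec_E2 (ho : Primrec₂ out) : Primrec₂ (E2 out) := by
  have hc : Primrec (fun r : ((ℕ × ℕ × ℕ) × BStr) × ℕ => cand out r.1.1.2.1 r.1.1.1 r.2) := by
    have : Primrec (fun r : ((ℕ × ℕ × ℕ) × BStr) × ℕ => (r.1.1.2.1, r.1.1.1, r.2)) := by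
      have a : Primrec (fun r : ((ℕ × ℕ × ℕ) × BStr) × ℕ => r.1.1) :=
        Primrec.fst.comp Primrec.fst
      exact Primrec.pair (Primrec.fst.comp (Primrec.snd.comp a))
        (Primrec.pair (Primrec.fst.comp a) Primrec.snd)
    exact (primrec_cand ho).comp this
  have hy : Primrec (fun r : ((ℕ × ℕ × ℕ) × BStr) × ℕ => r.1.2) := Primrec.snd.comp Primrec.fst
  have ha : Primrec (fun r : ((ℕ × ℕ × ℕ) × BStr) × ℕ => allStr r.1.1.2.2) :=
    primrec_allStr.comp (Primrec.snd.comp (Primrec.snd.comp (Primrec.fst.comp Primrec.fst)))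
  have hR : PrimrecRel (fun (p : BStr) (b : ℕ × BStr) => out b.1 p = some b.2) := by
    have h1 : Primrec (fun r : BStr × (ℕ × BStr) => out r.2.1 r.1) :=
      ho.comp (Primrec.fst.comp Primrec.snd) Primrec.fst
    have h2 : Primrec (fun r : BStr × (ℕ × BStr) => some r.2.2) :=
      Primrec.option_some.comp (Primrec.snd.comp Primrec.snd)
    exact Primrec.eq.comp h1 h2
  have hp := (PrimrecRel.exists_mem_list hR).comp ha (Primrec.pair Primrec.snd hy)
  exact Primrec.ite ((primrec_mem hc (primrec_lst.comp hy)).and hp)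
    (Primrec.option_some.comp hc) (Primrec.const none)

theorem primrec_E1 (ho : Primrec₂ out) : Primrec₂ (E1 out) := by
  have hu : Primrec (fun r : (((ℕ × ℕ × ℕ) × (ℕ × ℕ)) × BStr) × ℕ => r.2.unpair) :=
    Primrec.unpair.comp Primrec.snd
  have h0 : Primrec (fun r : (((ℕ × ℕ × ℕ) × (ℕ × ℕ)) × BStr) × ℕ =>
      (decode r.2.unpair.2 : Option BStr)) := Primrec.decode.comp (Primrec.snd.comp hu)
  have h1 : Primrec (fun r : ((((ℕ × ℕ × ℕ) × (ℕ × ℕ)) × BStr) × ℕ) × BStr =>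
      out r.1.2.unpair.1 r.2) := ho.comp (Primrec.fst.comp (hu.comp Primrec.fst)) Primrec.snd
  have b1 : Primrec (fun r : (((((ℕ × ℕ × ℕ) × (ℕ × ℕ)) × BStr) × ℕ) × BStr) × BStr =>
      r.1.1.1.1) := Primrec.fst.comp (Primrec.fst.comp (Primrec.fst.comp Primrec.fst))
  have bu : Primrec (fun r : (((((ℕ × ℕ × ℕ) × (ℕ × ℕ)) × BStr) × ℕ) × BStr) × BStr =>
      r.1.1.2.unpair.1) := Primrec.fst.comp (hu.comp (Primrec.fst.comp Primrec.fst))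
  have bp : Primrec (fun r : (((((ℕ × ℕ × ℕ) × (ℕ × ℕ)) × BStr) × ℕ) × BStr) × BStr =>
      r.1.2) := Primrec.snd.comp Primrec.fst
  have hyy : Primrec (fun r : (((((ℕ × ℕ × ℕ) × (ℕ × ℕ)) × BStr) × ℕ) × BStr) × BStr =>
      r.2) := Primrec.snd
  have bm := Primrec.fst.comp b1
  have bn := Primrec.fst.comp bm
  have bal := Primrec.fst.comp (Primrec.snd.comp bm)
  have ba := Primrec.snd.comp (Primrec.snd.comp bm)
  have bs := Primrec.fst.comp (Primrec.snd.comp b1)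
  have bd := Primrec.snd.comp (Primrec.snd.comp b1)
  have bL := (primrec_enumL (primrec_E2 ho)).comp (Primrec.pair bm hyy) bu
  have h2 : Primrec (fun r : (((((ℕ × ℕ × ℕ) × (ℕ × ℕ)) × BStr) × ℕ) × BStr) × BStr =>
    if (r.1.2.length = r.1.1.1.1.1.2.2 ∧ lev r.1.1.1.1.1.1 r.2 = r.1.1.1.1.2.1) ∧
      2 ^ (r.1.1.1.1.2.1 + r.1.1.1.1.1.2.1 + r.1.1.1.1.2.2) ≤
        (enumL (E2 out (r.1.1.1.1.1, r.2)) r.1.1.2.unpair.1).length * 2 ^ r.1.1.1.1.1.1 then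
      some r.2 else none) := by
    refine Primrec.ite (((Primrec.eq.comp (Primrec.list_length.comp bp) ba).and
      (Primrec.eq.comp (primrec_lev.comp bn hyy) bs)).and ?_)
      (Primrec.option_some.comp hyy) (Primrec.const none)
    exact Primrec.nat_le.comp
      (primrec_two_pow.comp (Primrec.nat_add.comp (Primrec.nat_add.comp bs bal) bd))
      (Primrec.nat_mul.comp (Primrec.list_length.comp bL) (primrec_two_pow.comp bn))
  exact Primrec.option_bind h0 (Primrec.option_bind h1 h2.to₂).to₂

end process

section comb
variable {out : ℕ → BStr → Option BStr}

theorem pw_some {al n t : ℕ} {x p y : BStr} (h : out t p = some y) :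
    pw out al n t x p =
      if x ∈ lst y then 2 ^ (al - p.length) * 2 ^ (n - lev n y) else 0 := by
  simp [pw, h]

theorem sum_pw_le (al n t : ℕ) (p : BStr) :
    ∑ x ∈ (allStr n).toFinset, pw out al n t x p ≤ 2 ^ (al - p.length) * 2 ^ (n + 1) := by
  cases h : out t p with
  | none => simp [pw, h]
  | some y =>
    simp only [pw_some h]
    rw [← Finset.sum_filter, Finset.sum_const, smul_eq_mul]
    calc _ ≤ 2 ^ (lev n y + 1) * (2 ^ (al - p.length) * 2 ^ (n - lev n y)) :=
          Nat.mul_le_mul_right _ (card_filter_lst n y)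
      _ = 2 ^ (al - p.length) * (2 ^ (lev n y + 1) * 2 ^ (n - lev n y)) := by ring
      _ = _ := by
        rw [← pow_add]
        congr 2
        have := lev_le n y
        omega

theorem sum_leStr (al : ℕ) : ∑ p ∈ (leStr al).toFinset, 2 ^ (al - p.length) = (al + 1) * 2 ^ al := by
  rw [List.sum_toFinset _ (nodup_leStr al), leStr]
  have key : ∀ k, k ≤ al + 1 →
      (((List.range k).flatMap allStr).map (fun p => 2 ^ (al - p.length))).sum = k * 2 ^ al := by
    intro k hk
    induction k with
    | zero => simp
    | succ k ih =>
      rw [List.range_succ, List.flatMap_append, List.map_append, List.sum_append, ih (by omega)]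
      have : ((allStr k).map (fun p => 2 ^ (al - p.length))) =
          (allStr k).map (fun _ => 2 ^ (al - k)) := by
        refine List.map_congr_left ?_
        intro p hp
        rw [(mem_allStr k p).1 hp]
      simp only [List.flatMap_cons, List.flatMap_nil, List.append_nil]
      rw [this, List.map_const', List.sum_replicate, length_allStr, smul_eq_mul, ← pow_add]
      have : k + (al - k) = al := by omega
      rw [this]; ring
  exact key _ le_rfl

theorem cand_spec (al n t : ℕ) :
    (cand out al n t).length = n ∧ wt out al n t (cand out al n t) ≤ (al + 1) * 2 ^ (al + 2) := by
  have hex : ∃ x ∈ allStr n, wt out al n t x ≤ (al + 1) * 2 ^ (al + 2) := by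
    by_contra hcon
    push Not at hcon
    have h1 : ∑ x ∈ (allStr n).toFinset, wt out al n t x ≤ (al + 1) * 2 ^ al * 2 ^ (n + 1) := by
      simp only [wt_eq]
      rw [Finset.sum_comm, ← sum_leStr, Finset.sum_mul]
      exact Finset.sum_le_sum (fun p _ => sum_pw_le al n t p)
    have h2 : ∑ x ∈ (allStr n).toFinset, (al + 1) * 2 ^ (al + 2) ≤
        ∑ x ∈ (allStr n).toFinset, wt out al n t x :=
      Finset.sum_le_sum (fun x hx => (hcon x (by simpa using hx)).le)
    rw [Finset.sum_const, smul_eq_mul, List.toFinset_card_of_nodup (nodup_allStr n),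
      length_allStr] at h2
    have h3 := h2.trans h1
    have h4 : 0 < (al + 1) * 2 ^ al * 2 ^ n := by positivity
    have e1 : 2 ^ n * ((al + 1) * 2 ^ (al + 2)) = 4 * ((al + 1) * 2 ^ al * 2 ^ n) := by ring
    have e2 : (al + 1) * 2 ^ al * 2 ^ (n + 1) = 2 * ((al + 1) * 2 ^ al * 2 ^ n) := by ring
    omega
  obtain ⟨x, hx, hw⟩ := hex
  have hlt : (allStr n).findIdx
      (fun x => decide (wt out al n t x ≤ (al + 1) * 2 ^ (al + 2))) < (allStr n).length :=
    List.findIdx_lt_length_of_exists ⟨x, hx, by simpa using hw⟩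
  have hc : cand out al n t = (allStr n)[(allStr n).findIdx
      (fun x => decide (wt out al n t x ≤ (al + 1) * 2 ^ (al + 2)))]'hlt := by
    rw [cand, List.getD_eq_getElem _ _ hlt]
  constructor
  · rw [← mem_allStr, hc]; exact List.getElem_mem _
  · have := List.findIdx_getElem (w := hlt)
    rw [← hc] at this
    simpa using this

/-- Monotonicity of the staged evaluation. -/
def Mono (out : ℕ → BStr → Option BStr) : Prop :=
  ∀ t t' p y, t ≤ t' → out t p = some y → out t' p = some y

/-- Programs halted by time `t`. -/
def HS (out : ℕ → BStr → Option BStr) (al t : ℕ) : Finset BStr :=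
  (leStr al).toFinset.filter (fun p => (out t p).isSome)

theorem HS_mono (hm : Mono out) (al : ℕ) {t t' : ℕ} (h : t ≤ t') : HS out al t ⊆ HS out al t' := by
  intro p hp
  simp only [HS, Finset.mem_filter] at hp ⊢
  obtain ⟨y, hy⟩ := Option.isSome_iff_exists.1 hp.2
  exact ⟨hp.1, by rw [hm _ _ _ _ h hy]; rfl⟩

theorem cand_eq_of_card (hm : Mono out) (al n : ℕ) {t t' : ℕ} (h : t ≤ t')
    (hc : (HS out al t').card ≤ (HS out al t).card) : cand out al n t = cand out al n t' := by
  have he : HS out al t = HS out al t' := Finset.eq_of_subset_of_card_le (HS_mono hm al h) hc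
  have ho : ∀ p ∈ (leStr al).toFinset, out t p = out t' p := by
    intro p hp
    cases h1 : out t p with
    | some y => rw [hm _ _ _ _ h h1]
    | none =>
      cases h2 : out t' p with
      | none => rfl
      | some y =>
        have : p ∈ HS out al t' := by simp [HS, h2]; simpa using hp
        rw [← he] at this
        simp [HS, h1] at this
  have hw : ∀ x, wt out al n t x = wt out al n t' x := by
    intro x
    rw [wt_eq, wt_eq]
    refine Finset.sum_congr rfl (fun p hp => ?_)
    simp only [pw, ho p hp]
  simp only [cand, hw]

theorem card_HS_lt (al t : ℕ) : (HS out al t).card < 2 ^ (al + 1) := by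
  have h1 : (HS out al t).card ≤ (leStr al).length :=
    (Finset.card_filter_le _ _).trans (List.toFinset_card_le _)
  have h2 : ∀ k, ((List.range k).flatMap allStr).length + 1 = 2 ^ k := by
    intro k
    induction k with
    | zero => simp
    | succ k ih =>
      rw [List.range_succ, List.flatMap_append, List.length_append]
      simp only [List.flatMap_cons, List.flatMap_nil, List.append_nil, length_allStr]
      rw [pow_succ]; omega
  have h3 := h2 (al + 1)
  rw [leStr] at h1
  omega

theorem card_cands (hm : Mono out) (al n T : ℕ) :
    ((Finset.range T).image (cand out al n)).card ≤ 2 ^ (al + 1) := by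
  have h : ∀ x ∈ (Finset.range T).image (cand out al n), ∃ t, cand out al n t = x := by
    intro x hx
    obtain ⟨t, _, h⟩ := Finset.mem_image.1 hx
    exact ⟨t, h⟩
  choose! f hf using h
  rw [← Finset.card_range (2 ^ (al + 1))]
  refine Finset.card_le_card_of_injOn (fun x => (HS out al (f x)).card) ?_ ?_
  · intro x _
    simpa using card_HS_lt al (f x)
  · intro x hx z hz hxz
    simp only at hxz
    rw [← hf x hx, ← hf z hz]
    rcases le_total (f x) (f z) with h | h
    · exact cand_eq_of_card hm al n h hxz.ge
    · exact (cand_eq_of_card hm al n h hxz.le).symm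

theorem cand_stable (hm : Mono out) (al n : ℕ) :
    ∃ T, ∀ t, T ≤ t → cand out al n t = cand out al n T := by
  have hb : ∃ M, ∀ t, (HS out al t).card ≤ M := ⟨_, fun t => (card_HS_lt al t).le⟩
  have hfin : (Set.range fun t => (HS out al t).card).Finite :=
    (Set.finite_Iio (2 ^ (al + 1))).subset (by rintro _ ⟨t, rfl⟩; exact card_HS_lt al t)
  obtain ⟨_, ⟨T, rfl⟩, hT⟩ := hfin.exists_maximal (Set.range_nonempty _)
  refine ⟨T, fun t ht => (cand_eq_of_card hm al n ht ?_).symm⟩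
  exact hT ⟨t, rfl⟩ (Finset.card_le_card (HS_mono hm al ht))

theorem E2_eq_some {n al a : ℕ} {y x : BStr} {t : ℕ} :
    E2 out ((n, al, a), y) t = some x ↔
      cand out al n t = x ∧ x ∈ lst y ∧ ∃ p, p.length = a ∧ out t p = some y := by
  unfold E2
  simp only [mem_allStr]
  split_ifs with h
  · constructor
    · intro h'
      cases h'
      exact ⟨rfl, h⟩
    · rintro ⟨rfl, _⟩; rfl
  · constructor
    · intro h'; cases h'
    · rintro ⟨rfl, h'⟩
      exact absurd h' h

/-- An allowed candidate lies in few sets of a given kind. -/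
theorem mult_bound {n al a s t : ℕ} (ha : a ≤ al) (hs : s ≤ n) {x : BStr}
    (hx : cand out al n t = x) (Y : Finset BStr)
    (hY : ∀ y ∈ Y, x ∈ lst y ∧ lev n y = s ∧ ∃ p : BStr, p.length = a ∧ out t p = some y) :
    Y.card * 2 ^ n ≤ (al + 1) * 2 ^ (a + s + 2) := by
  have h' : ∀ y ∈ Y, ∃ p : BStr, p.length = a ∧ out t p = some y := fun y hy => (hY y hy).2.2
  choose! f hf using h'
  have hinj : Set.InjOn f Y := by
    intro y hy z hz hyz
    have h1 := (hf y hy).2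
    have h2 := (hf z hz).2
    rw [hyz, h2] at h1
    exact (Option.some.inj h1).symm
  have h1 : Y.card * (2 ^ (al - a) * 2 ^ (n - s)) ≤ wt out al n t x := by
    rw [wt_eq]
    calc _ = ∑ p ∈ Y.image f, 2 ^ (al - a) * 2 ^ (n - s) := by
            rw [Finset.sum_const, Finset.card_image_of_injOn hinj, smul_eq_mul]
      _ ≤ ∑ p ∈ Y.image f, pw out al n t x p := by
            refine Finset.sum_le_sum ?_
            intro p hp
            obtain ⟨y, hy, rfl⟩ := Finset.mem_image.1 hp
            rw [pw_some (hf y hy).2, if_pos (hY y hy).1, (hf y hy).1, (hY y hy).2.1]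
      _ ≤ _ := by
            refine Finset.sum_le_sum_of_subset ?_
            intro p hp
            obtain ⟨y, hy, rfl⟩ := Finset.mem_image.1 hp
            simp only [List.mem_toFinset, mem_leStr, (hf y hy).1]
            exact ha
  have h2 := h1.trans (hx ▸ (cand_spec (out := out) al n t).2)
  have h3 := Nat.mul_le_mul_right (2 ^ (a + s)) h2
  have e1 : Y.card * (2 ^ (al - a) * 2 ^ (n - s)) * 2 ^ (a + s) = (Y.card * 2 ^ n) * 2 ^ al := by
    have h1 : 2 ^ al = 2 ^ (al - a) * 2 ^ a := by rw [← pow_add]; congr 1; omega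
    have h2 : 2 ^ n = 2 ^ (n - s) * 2 ^ s := by rw [← pow_add]; congr 1; omega
    rw [h1, h2, pow_add]; ring
  have e2 : (al + 1) * 2 ^ (al + 2) * 2 ^ (a + s) = ((al + 1) * 2 ^ (a + s + 2)) * 2 ^ al := by
    ring
  rw [e1, e2] at h3
  exact Nat.le_of_mul_le_mul_right h3 (by positivity)

theorem bad_bound (hm : Mono out) {n al a s d : ℕ} (ha : a ≤ al) (hs : s ≤ n) (w : BStr) (T : ℕ) :
    (enumL (E1 out (((n, al, a), (s, d)), w)) T).length * 2 ^ d ≤ (al + 1) * 2 ^ (a + 3) := by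
  set B := (enumL (E1 out (((n, al, a), (s, d)), w)) T).toFinset with hB
  set X := (Finset.range T).image (cand out al n) with hX
  set R : BStr → BStr → Prop := fun y x => x ∈ enumL (E2 out ((n, al, a), y)) T with hR
  have hBc : (enumL (E1 out (((n, al, a), (s, d)), w)) T).length = B.card :=
    (List.toFinset_card_of_nodup (nodup_enumL _ _)).symm
  rw [hBc]
  have hb : ∀ y ∈ B, lev n y = s ∧
      2 ^ (s + al + d) ≤ (enumL (E2 out ((n, al, a), y)) T).length * 2 ^ n := by
    intro y hy
    rw [hB, List.mem_toFinset, mem_enumL] at hy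
    obtain ⟨t, ht, h⟩ := hy
    unfold E1 at h
    obtain ⟨p, hp, h⟩ := Option.bind_eq_some_iff.1 h
    obtain ⟨y', hy', h⟩ := Option.bind_eq_some_iff.1 h
    split_ifs at h with hc
    obtain rfl := Option.some.inj h
    refine ⟨hc.1.2, hc.2.trans (Nat.mul_le_mul_right _ ?_)⟩
    exact (prefix_enumL _ ((Nat.unpair_left_le t).trans ht.le)).length_le
  have habove : ∀ y ∈ B, 2 ^ (s + al + d) ≤ (X.bipartiteAbove R y).card * 2 ^ n := by
    intro y hy
    refine (hb y hy).2.trans (Nat.mul_le_mul_right _ ?_)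
    rw [← List.toFinset_card_of_nodup (nodup_enumL _ _)]
    refine Finset.card_le_card ?_
    intro x hx
    rw [List.mem_toFinset] at hx
    rw [Finset.mem_bipartiteAbove]
    refine ⟨?_, hx⟩
    obtain ⟨t, ht, h⟩ := (mem_enumL _ _ _).1 hx
    exact Finset.mem_image.2 ⟨t, Finset.mem_range.2 ht, (E2_eq_some.1 h).1⟩
  have hbelow : ∀ x ∈ X, (B.bipartiteBelow R x).card * 2 ^ n ≤ (al + 1) * 2 ^ (a + s + 2) := by
    intro x hx
    have hne : ((Finset.range T).filter (fun t => cand out al n t = x)).Nonempty := by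
      obtain ⟨t, ht, h⟩ := Finset.mem_image.1 hx
      exact ⟨t, Finset.mem_filter.2 ⟨ht, h⟩⟩
    have hmax := Finset.max'_mem _ hne
    refine mult_bound (t := Finset.max' _ hne) ha hs (Finset.mem_filter.1 hmax).2 _ ?_
    intro y hy
    rw [Finset.mem_bipartiteBelow] at hy
    obtain ⟨t, ht, h⟩ := (mem_enumL _ _ _).1 hy.2
    obtain ⟨h1, h2, p, hp, h3⟩ := E2_eq_some.1 h
    refine ⟨h2, (hb y hy.1).1, p, hp, hm t _ p y ?_ h3⟩
    exact Finset.le_max' _ _ (Finset.mem_filter.2 ⟨Finset.mem_range.2 ht, h1⟩)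
  have hdc := Finset.sum_card_bipartiteAbove_eq_sum_card_bipartiteBelow (s := B) (t := X) R
  have h1 : B.card * 2 ^ (s + al + d) ≤ 2 ^ (al + 1) * ((al + 1) * 2 ^ (a + s + 2)) := by
    calc B.card * 2 ^ (s + al + d) = ∑ y ∈ B, 2 ^ (s + al + d) := by
          rw [Finset.sum_const, smul_eq_mul]
      _ ≤ ∑ y ∈ B, (X.bipartiteAbove R y).card * 2 ^ n := Finset.sum_le_sum habove
      _ = ∑ x ∈ X, (B.bipartiteBelow R x).card * 2 ^ n := by
          rw [← Finset.sum_mul, ← Finset.sum_mul, hdc]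
      _ ≤ ∑ x ∈ X, (al + 1) * 2 ^ (a + s + 2) := Finset.sum_le_sum hbelow
      _ = X.card * ((al + 1) * 2 ^ (a + s + 2)) := by rw [Finset.sum_const, smul_eq_mul]
      _ ≤ _ := Nat.mul_le_mul_right _ (card_cands hm al n T)
  have e1 : B.card * 2 ^ (s + al + d) = (B.card * 2 ^ d) * 2 ^ (s + al) := by ring
  have e2 : 2 ^ (al + 1) * ((al + 1) * 2 ^ (a + s + 2)) = ((al + 1) * 2 ^ (a + 3)) * 2 ^ (s + al) := by
    ring
  rw [e1, e2] at h1
  exact Nat.le_of_mul_le_mul_right h1 (by positivity)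

end comb

theorem exists_out (U : UniversalPrefixMachine) :
    ∃ out : ℕ → BStr → Option BStr, Primrec₂ out ∧ Mono out ∧
      ∀ p y, y ∈ U.eval p [] ↔ ∃ t, out t p = some y := by
  have h0 : Partrec fun p : BStr => U.eval p [] :=
    U.partrec'.comp (Computable.pair Computable.id (Computable.const []))
  obtain ⟨c, hc⟩ := Nat.Partrec.Code.exists_code.1 h0
  have hev : ∀ p : BStr, c.eval (encode p) = (U.eval p []).map encode := by
    intro p
    rw [hc]
    simp
  refine ⟨fun t p => (Nat.Partrec.Code.evaln t c (encode p)).bind decode, ?_, ?_, ?_⟩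
  · refine Primrec.option_bind (f := fun q : ℕ × BStr => Nat.Partrec.Code.evaln q.1 c (encode q.2))
      (g := fun _ k => (decode k : Option BStr)) ?_ (Primrec.decode.comp Primrec.snd)
    exact Nat.Partrec.Code.primrec_evaln.comp
      (Primrec.pair (Primrec.pair Primrec.fst (Primrec.const c)) (Primrec.encode.comp Primrec.snd))
  · intro t t' p y htt h
    obtain ⟨k, hk, h⟩ := Option.bind_eq_some_iff.1 h
    exact Option.bind_eq_some_iff.2 ⟨k, Nat.Partrec.Code.evaln_mono htt hk, h⟩
  · intro p y
    constructor
    · intro h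
      have h1 : encode y ∈ c.eval (encode p) := by
        rw [hev]; exact Part.mem_map _ h
      obtain ⟨t, ht⟩ := Nat.Partrec.Code.evaln_complete.1 h1
      exact ⟨t, Option.bind_eq_some_iff.2 ⟨_, ht, encodek y⟩⟩
    · rintro ⟨t, h⟩
      obtain ⟨k, hk, h⟩ := Option.bind_eq_some_iff.1 h
      have h1 : k ∈ c.eval (encode p) := Nat.Partrec.Code.evaln_sound hk
      rw [hev] at h1
      obtain ⟨y', hy', rfl⟩ := (Part.mem_map_iff _).1 h1
      rw [encodek] at h
      rw [← Option.some.inj h]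
      exact hy'

theorem exists_prog (U : UniversalPrefixMachine) (x : BStr) : ∃ p, x ∈ U.eval p [] := by
  obtain ⟨c, hc⟩ := enum_bound U (μ := BStr) (fun q _ => some q.1)
    (Primrec.option_some.comp (Primrec.fst.comp Primrec.fst))
  obtain ⟨p, _, h⟩ := hc x [] 0 x ⟨0, rfl⟩ (by
    intro T
    rw [← List.toFinset_card_of_nodup (nodup_enumL _ _)]
    refine (Finset.card_le_card (t := {x}) ?_).trans (by simp)
    intro z hz
    rw [List.mem_toFinset, mem_enumL] at hz
    obtain ⟨_, _, h⟩ := hz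
    simpa using (Option.some.inj h).symm)
  exact ⟨p, h⟩

theorem pair_lt {a b k j : ℕ} (ha : a < 2 ^ k) (hb : b < 2 ^ k) (hj : 2 * k ≤ j) :
    Nat.pair a b < 2 ^ j := by
  have h1 := Nat.pair_lt_max_add_one_sq a b
  have h2 : max a b + 1 ≤ 2 ^ k := by
    have := max_lt ha hb
    omega
  calc Nat.pair a b < (max a b + 1) ^ 2 := h1
    _ ≤ (2 ^ k) ^ 2 := Nat.pow_le_pow_left h2 2
    _ = 2 ^ (2 * k) := by rw [← pow_mul]; congr 1; ring
    _ ≤ 2 ^ j := Nat.pow_le_pow_right (by norm_num) hj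

theorem main_nat (U : UniversalPrefixMachine) : ∃ C1 : ℕ, ∀ n al : ℕ,
    al + 65 * Nat.size n + C1 ≤ n → ∃ x : BStr, x.length = n ∧
      ∀ S : Finset BStr, x ∈ S → U.Kset S ≤ al →
        ∃ s : ℕ, 2 ^ s ≤ S.card ∧ U.KcS x S + n ≤ s + al + 65 * Nat.size n + C1 := by
  obtain ⟨out, ho, hm, hout⟩ := exists_out U
  obtain ⟨c1, hc1⟩ := enum_bound U (E1 out) (primrec_E1 ho)
  obtain ⟨c2, hc2⟩ := enum_bound U (E2 out) (primrec_E2 ho)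
  refine ⟨c1 + c2 + 4, ?_⟩
  intro n al hn
  set z := Nat.size n with hz
  have hnz : n < 2 ^ z := Nat.lt_size_self n
  obtain ⟨T, hT⟩ := cand_stable hm al n
  refine ⟨cand out al n T, (cand_spec al n T).1, ?_⟩
  intro S hxS hKS
  set x := cand out al n T with hx
  set a := U.Kset S with ha
  set y := code S with hy
  set s := lev n y with hs
  have hsn : s ≤ n := lev_le n y
  obtain ⟨p0, hp0⟩ := exists_prog U y
  have hmem : a ∈ {k | ∃ p : BStr, p.length = k ∧ y ∈ U.eval p []} :=
    Nat.sInf_mem ⟨_, p0, rfl, hp0⟩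
  obtain ⟨p, hpa, hpy⟩ := hmem
  obtain ⟨u, hu⟩ := (hout p y).1 hpy
  have hmin : ∀ q : BStr, y ∈ U.eval q [] → a ≤ q.length := fun q hq =>
    Nat.sInf_le ⟨q, rfl, hq⟩
  set e := 32 * z + c1 + 1 with he
  set d := z + 3 + e with hd
  have hz3 : Nat.pair n (Nat.pair al a) < 2 ^ (4 * z) := by
    refine pair_lt (k := 2 * z) (hnz.trans_le ?_) (pair_lt (k := z) ?_ ?_ le_rfl) (by omega)
    · exact Nat.pow_le_pow_right (by norm_num) (by omega)
    · omega
    · omega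
  have hpowmono : ∀ {v k j : ℕ}, v < 2 ^ k → k ≤ j → v < 2 ^ j := fun h h' =>
    h.trans_le (Nat.pow_le_pow_right (by norm_num) h')
  -- the set `S` is not bad
  have hgood : ∀ t, (enumL (E2 out ((n, al, a), y)) t).length * 2 ^ n < 2 ^ (s + al + d) := by
    by_contra hcon
    push Not at hcon
    obtain ⟨t, ht⟩ := hcon
    have hE : E1 out (((n, al, a), (s, d)), []) (Nat.pair (max u t) (encode p)) = some y := by
      unfold E1
      rw [Nat.unpair_pair]
      simp only [encodek, Option.bind_some, hm _ _ _ _ (le_max_left u t) hu]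
      rw [if_pos]
      refine ⟨⟨hpa, rfl⟩, ht.trans (Nat.mul_le_mul_right _ ?_)⟩
      exact (prefix_enumL _ (le_max_right u t)).length_le
    have hlen : ∀ V, (enumL (E1 out (((n, al, a), (s, d)), [])) V).length * 2 ^ e ≤ 2 ^ a := by
      intro V
      have h1 := bad_bound hm (d := d) hKS hsn [] V
      have h2 : al + 1 ≤ 2 ^ z := by omega
      have h3 := h1.trans (Nat.mul_le_mul_right _ h2)
      have e1 : (enumL (E1 out (((n, al, a), (s, d)), [])) V).length * 2 ^ d =
          (enumL (E1 out (((n, al, a), (s, d)), [])) V).length * 2 ^ e * 2 ^ (z + 3) := by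
        rw [hd, pow_add 2 (z + 3) e]; ring
      have e2 : 2 ^ z * 2 ^ (a + 3) = 2 ^ a * 2 ^ (z + 3) := by ring
      rw [e1, e2] at h3
      exact Nat.le_of_mul_le_mul_right h3 (by positivity)
    have hea : e ≤ a := by
      have h1 := hlen (Nat.pair (max u t) (encode p) + 1)
      have h2 : y ∈ enumL (E1 out (((n, al, a), (s, d)), [])) (Nat.pair (max u t) (encode p) + 1) :=
        (mem_enumL _ _ _).2 ⟨_, Nat.lt_succ_self _, hE⟩
      have h3 := List.length_pos_of_mem h2
      have h4 : 2 ^ e ≤ 2 ^ a := (Nat.le_mul_of_pos_left _ h3).trans h1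
      exact (Nat.pow_le_pow_iff_right (by norm_num)).1 h4
    obtain ⟨q, hq, hqy⟩ := hc1 ((n, al, a), (s, d)) [] (a - e) y ⟨_, hE⟩ (by
      intro V
      have h1 := hlen V
      have h2 : 2 ^ a = 2 ^ (a - e) * 2 ^ e := by rw [← pow_add]; congr 1; omega
      rw [h2] at h1
      exact Nat.le_of_mul_le_mul_right h1 (by positivity))
    have h1 := hmin q hqy
    have h2 : Nat.size (Nat.pair (a - e) (encode ((n, al, a), (s, d)))) ≤ 16 * z := by
      rw [Nat.size_le]
      refine pair_lt (k := 8 * z) (hpowmono (k := z) (by omega) (by omega)) ?_ (by omega)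
      change Nat.pair (Nat.pair n (Nat.pair al a)) (Nat.pair s d) < _
      refine pair_lt hz3 (pair_lt (k := z) ?_ ?_ (by omega)) (by omega)
      · omega
      · omega
    omega
  -- the string `x` is enumerated by `E2`
  have hxE : E2 out ((n, al, a), y) (max T u) = some x := by
    rw [E2_eq_some]
    refine ⟨hT _ (le_max_left _ _), (mem_lst_code S x).2 hxS, p, hpa, ?_⟩
    exact hm _ _ _ _ (le_max_right _ _) hu
  have hsd : n ≤ s + al + d := by
    have h1 := hgood (max T u + 1)
    have h2 : x ∈ enumL (E2 out ((n, al, a), y)) (max T u + 1) :=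
      (mem_enumL _ _ _).2 ⟨_, Nat.lt_succ_self _, hxE⟩
    have h3 := List.length_pos_of_mem h2
    have h4 : 2 ^ n < 2 ^ (s + al + d) := (Nat.le_mul_of_pos_left _ h3).trans_lt h1
    exact ((Nat.pow_lt_pow_iff_right (by norm_num)).1 h4).le
  obtain ⟨q, hq, hqx⟩ := hc2 (n, al, a) y (s + al + d - n) x ⟨_, hxE⟩ (by
    intro V
    have h1 := (hgood V).le
    have h2 : 2 ^ (s + al + d) = 2 ^ (s + al + d - n) * 2 ^ n := by
      rw [← pow_add]; congr 1; omega
    rw [h2] at h1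
    exact Nat.le_of_mul_le_mul_right h1 (by positivity))
  have hK : U.KcS x S ≤ q.length := Nat.sInf_le ⟨q, rfl, hqx⟩
  have hsz : Nat.size (Nat.pair (s + al + d - n) (encode (n, al, a))) ≤ 16 * z := by
    rw [Nat.size_le]
    refine pair_lt (k := 8 * z) (hpowmono (k := z) (by omega) (by omega)) ?_ (by omega)
    change Nat.pair n (Nat.pair al a) < _
    exact hpowmono hz3 (by omega)
  refine ⟨s, ?_, by omega⟩
  rw [← length_lst_code]
  refine two_pow_lev_le n y ?_
  exact List.ne_nil_of_mem ((mem_lst_code S x).2 hxS)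

end NS

/-- There are constants `c` and `C` such that for every `n` and
all `α0`, `β0` with `α0 + β0 < n − c·log n − C`, there is a string `x` of
length `n` that is not `(α0,β0)`-stochastic, i.e. `β_x(α0) > β0`. -/
theorem statement19 (U : UniversalPrefixMachine) :
    ∃ c C : ℕ, ∀ n α0 β0 : ℕ,
      (α0 : ℝ) + (β0 : ℝ) < (n : ℝ) - (c : ℝ) * Real.logb 2 (n : ℝ) - (C : ℝ) →
      ∃ x : BStr, x.length = n ∧ (((β0 : ℕ) : ℝ) : EReal) < U.betaF x α0 := by
  obtain ⟨C1, hC1⟩ := NS.main_nat U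
  refine ⟨65, 66 + C1, ?_⟩
  intro n al be h
  have hsz : (Nat.size n : ℝ) ≤ Real.logb 2 n + 1 := by
    have h1 : Nat.size n ≤ Nat.log 2 n + 1 := by
      rw [Nat.size_le]
      exact Nat.lt_pow_succ_log_self (by norm_num) n
    have h2 : ((Nat.log 2 n : ℕ) : ℝ) ≤ Real.logb 2 n := by
      exact_mod_cast Real.natLog_le_logb n 2
    have h3 : (Nat.size n : ℝ) ≤ (Nat.log 2 n : ℝ) + 1 := by exact_mod_cast h1
    linarith
  push_cast at h
  have hn : al + be + 65 * Nat.size n + C1 + 1 ≤ n := by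
    have : (al : ℝ) + be + 65 * Nat.size n + C1 + 1 ≤ n := by linarith
    exact_mod_cast this
  obtain ⟨x, hx, hS⟩ := hC1 n al (by omega)
  refine ⟨x, hx, ?_⟩
  have hlt : (((be : ℕ) : ℝ) : EReal) < (((be : ℝ) + 1 : ℝ) : EReal) :=
    EReal.coe_lt_coe_iff.2 (by linarith)
  refine hlt.trans_le (le_sInf ?_)
  rintro r ⟨S, hxS, hKS, rfl⟩
  obtain ⟨s, hs, hK⟩ := hS S hxS hKS
  rw [EReal.coe_le_coe_iff, UniversalPrefixMachine.deficiency]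
  have h1 : (s : ℝ) ≤ Real.logb 2 (S.card : ℝ) := by
    have hpos : (0 : ℝ) < (S.card : ℝ) := by exact_mod_cast Finset.card_pos.2 ⟨x, hxS⟩
    rw [Real.le_logb_iff_rpow_le (by norm_num) hpos, Real.rpow_natCast]
    exact_mod_cast hs
  have h2 : (U.KcS x S : ℝ) + be + 1 ≤ s := by
    have : U.KcS x S + be + 1 ≤ s := by omega
    exact_mod_cast this
  linarith
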